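/- arXiv:1711.07678 — 5 statements merged into one kernel-verified Lean document; each statement's English description precedes it below -/
import Mathlib

section
/- Let 0 < y₀ < y₁ be real numbers and T > 0. Suppose y : ℝ × ℝ → ℝ is such that y and its partial derivatives ∂ₜy, ∂ₓy, ∂ₓ²y exist and are continuous on [0,T] × [0,1], ∂ₜy(t,x) = ∂ₓ²y(t,x) for all (t,x) ∈ [0,T] × [0,1], y(0,x) = y₀ for all x ∈ [0,1], y(T,x) = y₁ for all x ∈ [0,1], and the boundary controls are nonnegative: y(t,0) ≥ 0 and y(t,1) ≥ 0 for all t ∈ [0,T]. Then T ≥ (1/(8π²)) · log(9(y₁ − y₀)/y₁). -/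
open MeasureTheory Set Filter Topology in
lemma aux_cont (T : ℝ) (f : ℝ → ℝ → ℝ) (k : ℝ)
    (hf : ContinuousOn (fun q : ℝ × ℝ => f q.1 q.2) (Icc 0 T ×ˢ Icc 0 1)) :
    ContinuousOn (fun t => ∫ x in (0:ℝ)..1, f t x * Real.sin (k * x)) (Icc 0 T) := by
  obtain ⟨C, hC⟩ := (isCompact_Icc.prod isCompact_Icc).exists_bound_of_continuousOn hf
  have hslice : ∀ t ∈ Icc (0:ℝ) T, ContinuousOn (fun x => f t x) (Icc 0 1) := fun t ht =>
    hf.comp (f := fun x => ((t, x) : ℝ × ℝ)) (by fun_prop) (fun x hx => ⟨ht, hx⟩)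
  intro t ht
  refine intervalIntegral.continuousWithinAt_of_dominated_interval (bound := fun _ => C) ?_ ?_ ?_ ?_
  · filter_upwards [self_mem_nhdsWithin] with s hs
    refine ContinuousOn.aestronglyMeasurable ?_ measurableSet_uIoc
    refine ContinuousOn.mul ((hslice s hs).mono ?_) (by fun_prop)
    rw [uIoc_of_le zero_le_one]; exact Ioc_subset_Icc_self
  · filter_upwards [self_mem_nhdsWithin] with s hs
    refine Eventually.of_forall fun x hx => ?_
    rw [uIoc_of_le zero_le_one] at hx
    have h1 := hC (s, x) ⟨hs, Ioc_subset_Icc_self hx⟩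
    rw [norm_mul]
    have h2 : ‖Real.sin (k * x)‖ ≤ 1 := Real.abs_sin_le_one _
    have h3 := norm_nonneg (f s x)
    have h4 := norm_nonneg (Real.sin (k * x))
    simp only at h1
    nlinarith
  · exact intervalIntegrable_const
  · refine Eventually.of_forall fun x hx => ?_
    rw [uIoc_of_le zero_le_one] at hx
    refine ContinuousWithinAt.mul ?_ continuousWithinAt_const
    exact (hf.comp (f := fun t => ((t, x) : ℝ × ℝ)) (by fun_prop)
      (fun s hs => ⟨hs, Ioc_subset_Icc_self hx⟩)) t ht

open MeasureTheory Set Filter Topology in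
lemma aux_deriv (T : ℝ) (f f' : ℝ → ℝ → ℝ) (k : ℝ)
    (hf : ContinuousOn (fun q : ℝ × ℝ => f q.1 q.2) (Icc 0 T ×ˢ Icc 0 1))
    (hf' : ContinuousOn (fun q : ℝ × ℝ => f' q.1 q.2) (Icc 0 T ×ˢ Icc 0 1))
    (hd : ∀ t ∈ Icc (0:ℝ) T, ∀ x ∈ Icc (0:ℝ) 1, HasDerivAt (fun s => f s x) (f' t x) t)
    (t : ℝ) (ht : t ∈ Ioo 0 T) :
    HasDerivAt (fun t => ∫ x in (0:ℝ)..1, f t x * Real.sin (k * x))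
      (∫ x in (0:ℝ)..1, f' t x * Real.sin (k * x)) t := by
  obtain ⟨C, hC⟩ := (isCompact_Icc.prod isCompact_Icc).exists_bound_of_continuousOn hf'
  have hslice : ∀ t ∈ Icc (0:ℝ) T, ContinuousOn (fun x => f t x) (Icc 0 1) := fun t ht =>
    hf.comp (f := fun x => ((t, x) : ℝ × ℝ)) (by fun_prop) (fun x hx => ⟨ht, hx⟩)
  have hslice' : ∀ t ∈ Icc (0:ℝ) T, ContinuousOn (fun x => f' t x) (Icc 0 1) := fun t ht =>
    hf'.comp (f := fun x => ((t, x) : ℝ × ℝ)) (by fun_prop) (fun x hx => ⟨ht, hx⟩)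
  have hsub : uIoc (0:ℝ) 1 ⊆ Icc 0 1 := by
    rw [uIoc_of_le zero_le_one]; exact Ioc_subset_Icc_self
  refine (intervalIntegral.hasDerivAt_integral_of_dominated_loc_of_deriv_le
    (F := fun t x => f t x * Real.sin (k * x))
    (F' := fun t x => f' t x * Real.sin (k * x)) (bound := fun _ => C)
    (Ioo_mem_nhds ht.1 ht.2) ?_ ?_ ?_ ?_ ?_ ?_).2
  · filter_upwards [Ioo_mem_nhds ht.1 ht.2] with s hs
    refine ContinuousOn.aestronglyMeasurable ?_ measurableSet_uIoc
    exact ContinuousOn.mul ((hslice s (Ioo_subset_Icc_self hs)).mono hsub) (by fun_prop)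
  · refine ContinuousOn.intervalIntegrable ?_
    rw [uIcc_of_le zero_le_one]
    exact ContinuousOn.mul (hslice t (Ioo_subset_Icc_self ht)) (by fun_prop)
  · refine ContinuousOn.aestronglyMeasurable ?_ measurableSet_uIoc
    exact ContinuousOn.mul ((hslice' t (Ioo_subset_Icc_self ht)).mono hsub) (by fun_prop)
  · refine Eventually.of_forall fun x hx s hs => ?_
    have h1 := hC (s, x) ⟨Ioo_subset_Icc_self hs, hsub hx⟩
    rw [norm_mul]
    have h2 : ‖Real.sin (k * x)‖ ≤ 1 := Real.abs_sin_le_one _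
    have h3 := norm_nonneg (f' s x)
    have h4 := norm_nonneg (Real.sin (k * x))
    simp only at h1
    nlinarith
  · exact intervalIntegrable_const
  · refine Eventually.of_forall fun x hx s hs => ?_
    exact (hd s (Ioo_subset_Icc_self hs) x (hsub hx)).mul_const _

open MeasureTheory Set in
lemma aux_parts (g g' g'' : ℝ → ℝ) (k : ℝ) (hs : Real.sin k = 0) (hc : Real.cos k = -1)
    (h1 : ∀ x ∈ Icc (0:ℝ) 1, HasDerivAt g (g' x) x)
    (h2 : ∀ x ∈ Icc (0:ℝ) 1, HasDerivAt g' (g'' x) x)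
    (hcont : ContinuousOn g'' (Icc 0 1)) :
    ∫ x in (0:ℝ)..1, g'' x * Real.sin (k * x)
      = k * (g 0 + g 1) - k ^ 2 * ∫ x in (0:ℝ)..1, g x * Real.sin (k * x) := by
  have hg : ContinuousOn g (Icc 0 1) := fun x hx => (h1 x hx).continuousAt.continuousWithinAt
  have i1 : IntervalIntegrable (fun x => g'' x * Real.sin (k * x)) volume 0 1 := by
    refine ContinuousOn.intervalIntegrable ?_
    rw [uIcc_of_le zero_le_one]
    exact hcont.mul (by fun_prop)
  have i2 : IntervalIntegrable (fun x => g x * Real.sin (k * x)) volume 0 1 := by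
    refine ContinuousOn.intervalIntegrable ?_
    rw [uIcc_of_le zero_le_one]
    exact hg.mul (by fun_prop)
  have key : ∫ x in (0:ℝ)..1, (g'' x * Real.sin (k * x) + k ^ 2 * (g x * Real.sin (k * x)))
      = (g' 1 * Real.sin (k * 1) - g 1 * (k * Real.cos (k * 1)))
        - (g' 0 * Real.sin (k * 0) - g 0 * (k * Real.cos (k * 0))) := by
    refine intervalIntegral.integral_eq_sub_of_hasDerivAt
      (f := fun x => g' x * Real.sin (k * x) - g x * (k * Real.cos (k * x))) ?_
      (i1.add (i2.const_mul _))
    intro x hx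
    rw [uIcc_of_le zero_le_one] at hx
    have hl : HasDerivAt (fun x : ℝ => k * x) k x := by
      simpa using (hasDerivAt_id x).const_mul k
    refine HasDerivAt.congr_deriv
      (((h2 x hx).mul hl.sin).sub ((h1 x hx).mul (hl.cos.const_mul k))) ?_
    ring
  rw [intervalIntegral.integral_add i1 (i2.const_mul _), intervalIntegral.integral_const_mul] at key
  simp only [mul_one, mul_zero, hs, hc, Real.sin_zero, Real.cos_zero] at key
  linarith

lemma aux_const (k c : ℝ) (hk : k ≠ 0) (hc : Real.cos k = -1) :
    ∫ x in (0:ℝ)..1, c * Real.sin (k * x) = 2 * c / k := by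
  rw [intervalIntegral.integral_const_mul, intervalIntegral.integral_comp_mul_left _ hk,
    integral_sin]
  simp [hc]
  field_simp
  ring


theorem stmt6 (y₀ y₁ T : ℝ) (hy₀ : 0 < y₀) (hy : y₀ < y₁) (hT : 0 < T)
    (y yt yx yxx : ℝ → ℝ → ℝ)
    -- `y` and all its partial derivatives are continuous on `[0,T] × [0,1]`
    (hy_cont : ContinuousOn (fun q : ℝ × ℝ => y q.1 q.2) (Set.Icc 0 T ×ˢ Set.Icc 0 1))
    (hyt_cont : ContinuousOn (fun q : ℝ × ℝ => yt q.1 q.2) (Set.Icc 0 T ×ˢ Set.Icc 0 1))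
    (hyx_cont : ContinuousOn (fun q : ℝ × ℝ => yx q.1 q.2) (Set.Icc 0 T ×ˢ Set.Icc 0 1))
    (hyxx_cont : ContinuousOn (fun q : ℝ × ℝ => yxx q.1 q.2) (Set.Icc 0 T ×ˢ Set.Icc 0 1))
    -- the partial derivatives exist on `[0,T] × [0,1]`
    (hyt : ∀ t ∈ Set.Icc (0:ℝ) T, ∀ x ∈ Set.Icc (0:ℝ) 1,
      HasDerivAt (fun s => y s x) (yt t x) t)
    (hyx : ∀ t ∈ Set.Icc (0:ℝ) T, ∀ x ∈ Set.Icc (0:ℝ) 1,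
      HasDerivAt (fun x' => y t x') (yx t x) x)
    (hyxx : ∀ t ∈ Set.Icc (0:ℝ) T, ∀ x ∈ Set.Icc (0:ℝ) 1,
      HasDerivAt (fun x' => yx t x') (yxx t x) x)
    -- `y` solves the heat equation
    (heq : ∀ t ∈ Set.Icc (0:ℝ) T, ∀ x ∈ Set.Icc (0:ℝ) 1, yt t x = yxx t x)
    -- initial and final data
    (hinit : ∀ x ∈ Set.Icc (0:ℝ) 1, y 0 x = y₀)
    (hfin : ∀ x ∈ Set.Icc (0:ℝ) 1, y T x = y₁)
    -- nonnegative boundary controls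
    (hbd : ∀ t ∈ Set.Icc (0:ℝ) T, 0 ≤ y t 0 ∧ 0 ≤ y t 1) :
    T ≥ 1 / (8 * Real.pi ^ 2) * Real.log (9 * (y₁ - y₀) / y₁) := by
  have hpi := Real.pi_pos
  have hs1 := Real.sin_pi
  have hc1 := Real.cos_pi
  have hs3 : Real.sin (3 * Real.pi) = 0 := by
    rw [Real.sin_three_mul, hs1]; ring
  have hc3 : Real.cos (3 * Real.pi) = -1 := by
    rw [Real.cos_three_mul, hc1]; norm_num
  set a : ℝ → ℝ → ℝ := fun k t => ∫ x in (0:ℝ)..1, y t x * Real.sin (k * x) with ha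
  have hcont : ∀ k, ContinuousOn (a k) (Set.Icc 0 T) := fun k => aux_cont T y k hy_cont
  have hderiv : ∀ k, Real.sin k = 0 → Real.cos k = -1 → ∀ t ∈ Set.Ioo 0 T,
      HasDerivAt (a k) (k * (y t 0 + y t 1) - k ^ 2 * a k t) t := by
    intro k hs hc t ht
    have ht' := Set.Ioo_subset_Icc_self ht
    have h := aux_deriv T y yt k hy_cont hyt_cont hyt t ht
    have e : ∫ x in (0:ℝ)..1, yt t x * Real.sin (k * x)
        = ∫ x in (0:ℝ)..1, yxx t x * Real.sin (k * x) := by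
      refine intervalIntegral.integral_congr fun x hx => ?_
      rw [Set.uIcc_of_le zero_le_one] at hx
      simp only [heq t ht' x hx]
    rw [e, aux_parts (y t) (yx t) (yxx t) k hs hc (hyx t ht') (hyxx t ht')
      (hyxx_cont.comp (f := fun x => ((t, x) : ℝ × ℝ)) (by fun_prop) (fun x hx => ⟨ht', hx⟩))] at h
    exact h
  have hval : ∀ k t c, k ≠ 0 → Real.cos k = -1 → (∀ x ∈ Set.Icc (0:ℝ) 1, y t x = c) →
      a k t = 2 * c / k := by
    intro k t c hk hc h
    rw [← aux_const k c hk hc]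
    refine intervalIntegral.integral_congr fun x hx => ?_
    rw [Set.uIcc_of_le zero_le_one] at hx
    simp only [h x hx]
  set p := Real.pi with hp
  let G : ℝ → ℝ := fun t => Real.exp (9 * p ^ 2 * t) * a (3 * p) t / 3
    - Real.exp (p ^ 2 * t) * a p t
  have hE : ∀ c t : ℝ, HasDerivAt (fun t => Real.exp (c * t)) (Real.exp (c * t) * c) t := by
    intro c t
    have hl : HasDerivAt (fun x : ℝ => c * x) c t := by
      simpa using (hasDerivAt_id t).const_mul c
    exact hl.exp
  have hG : ∀ t ∈ Set.Ioo 0 T, HasDerivAt G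
      (p * (y t 0 + y t 1) * (Real.exp (9 * p ^ 2 * t) - Real.exp (p ^ 2 * t))) t := by
    intro t ht
    refine HasDerivAt.congr_deriv
      ((((hE (9 * p ^ 2) t).mul (hderiv (3 * p) hs3 hc3 t ht)).div_const 3).sub
      ((hE (p ^ 2) t).mul (hderiv p hs1 hc1 t ht))) ?_
    ring
  have hmono : MonotoneOn G (Set.Icc 0 T) := by
    refine monotoneOn_of_deriv_nonneg (convex_Icc 0 T) ?_ ?_ ?_
    · refine ContinuousOn.sub ((ContinuousOn.mul (by fun_prop) (hcont _)).div_const 3)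
        (ContinuousOn.mul (by fun_prop) (hcont _))
    · rw [interior_Icc]
      exact fun t ht => (hG t ht).differentiableAt.differentiableWithinAt
    · rw [interior_Icc]
      intro t ht
      rw [(hG t ht).deriv]
      have hb := hbd t (Set.Ioo_subset_Icc_self ht)
      have : Real.exp (p ^ 2 * t) ≤ Real.exp (9 * p ^ 2 * t) := by
        apply Real.exp_le_exp.mpr
        have := mul_nonneg (sq_nonneg p) ht.1.le
        linarith
      exact mul_nonneg (mul_nonneg hpi.le (add_nonneg hb.1 hb.2)) (sub_nonneg.mpr this)
  have hfinal := hmono (Set.left_mem_Icc.mpr hT.le) (Set.right_mem_Icc.mpr hT.le) hT.le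
  have hp0 : p ≠ 0 := hpi.ne'
  simp only [G] at hfinal
  rw [hval p 0 y₀ hp0 hc1 hinit, hval p T y₁ hp0 hc1 hfin,
    hval (3 * p) 0 y₀ (by positivity) hc3 hinit,
    hval (3 * p) T y₁ (by positivity) hc3 hfin] at hfinal
  simp only [mul_zero, Real.exp_zero, one_mul] at hfinal
  have e9 : Real.exp (9 * p ^ 2 * T) = Real.exp (8 * p ^ 2 * T) * Real.exp (p ^ 2 * T) := by
    rw [← Real.exp_add]; congr 1; ring
  rw [e9] at hfinal
  have hX : 1 ≤ Real.exp (p ^ 2 * T) := Real.one_le_exp (by positivity)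
  set X := Real.exp (p ^ 2 * T)
  set Y := Real.exp (8 * p ^ 2 * T) with hY
  have h1 : 9 * X * y₁ - 8 * y₀ ≤ Y * X * y₁ := by
    have h := mul_le_mul_of_nonneg_left hfinal (show 0 ≤ 9 * p / 2 by positivity)
    have e1 : 9 * p / 2 * (2 * y₀ / (3 * p) / 3 - 2 * y₀ / p) = -8 * y₀ := by
      field_simp; ring
    have e2 : 9 * p / 2 * (Y * X * (2 * y₁ / (3 * p)) / 3 - X * (2 * y₁ / p))
        = Y * X * y₁ - 9 * X * y₁ := by
      field_simp
      ring
    rw [e1, e2] at h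
    linarith
  have hy1 : 0 < y₁ := hy₀.trans hy
  have h2 : 9 * (y₁ - y₀) ≤ Y * y₁ := by
    have : X * (9 * (y₁ - y₀)) ≤ X * (Y * y₁) := by nlinarith
    exact le_of_mul_le_mul_left this (by linarith)
  have h3 : Real.log (9 * (y₁ - y₀) / y₁) ≤ 8 * p ^ 2 * T := by
    rw [Real.log_le_iff_le_exp (by have := sub_pos.mpr hy; positivity), div_le_iff₀ hy1]
    exact h2
  rw [ge_iff_le, one_div, inv_mul_le_iff₀ (by positivity)]
  exact h3
end

section
/- Let y₀ > y₁ > 0 be real numbers and T > 0. Suppose y : ℝ × ℝ → ℝ is such that y and its partial derivatives ∂ₜy, ∂ₓy, ∂ₓ²y exist and are continuous on [0,T] × [0,1], ∂ₜy(t,x) = ∂ₓ²y(t,x) for all (t,x) ∈ [0,T] × [0,1], y(0,x) = y₀ for all x ∈ [0,1], y(T,x) = y₁ for all x ∈ [0,1], and y(t,0) ≥ 0 and y(t,1) ≥ 0 for all t ∈ [0,T]. Then T ≥ (1/π²) · log(y₀/y₁). -/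
theorem stmt7 (y₀ y₁ T : ℝ) (hy₁ : 0 < y₁) (hy : y₁ < y₀) (hT : 0 < T)
    (y yt yx yxx : ℝ → ℝ → ℝ)
    -- `y` and all its partial derivatives are continuous on `[0,T] × [0,1]`
    (hy_cont : ContinuousOn (fun q : ℝ × ℝ => y q.1 q.2) (Set.Icc 0 T ×ˢ Set.Icc 0 1))
    (hyt_cont : ContinuousOn (fun q : ℝ × ℝ => yt q.1 q.2) (Set.Icc 0 T ×ˢ Set.Icc 0 1))
    (hyx_cont : ContinuousOn (fun q : ℝ × ℝ => yx q.1 q.2) (Set.Icc 0 T ×ˢ Set.Icc 0 1))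
    (hyxx_cont : ContinuousOn (fun q : ℝ × ℝ => yxx q.1 q.2) (Set.Icc 0 T ×ˢ Set.Icc 0 1))
    -- the partial derivatives exist on `[0,T] × [0,1]`
    (hyt : ∀ t ∈ Set.Icc (0:ℝ) T, ∀ x ∈ Set.Icc (0:ℝ) 1,
      HasDerivAt (fun s => y s x) (yt t x) t)
    (hyx : ∀ t ∈ Set.Icc (0:ℝ) T, ∀ x ∈ Set.Icc (0:ℝ) 1,
      HasDerivAt (fun x' => y t x') (yx t x) x)
    (hyxx : ∀ t ∈ Set.Icc (0:ℝ) T, ∀ x ∈ Set.Icc (0:ℝ) 1,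
      HasDerivAt (fun x' => yx t x') (yxx t x) x)
    -- `y` solves the heat equation
    (heq : ∀ t ∈ Set.Icc (0:ℝ) T, ∀ x ∈ Set.Icc (0:ℝ) 1, yt t x = yxx t x)
    -- initial and final data
    (hinit : ∀ x ∈ Set.Icc (0:ℝ) 1, y 0 x = y₀)
    (hfin : ∀ x ∈ Set.Icc (0:ℝ) 1, y T x = y₁)
    -- nonnegative boundary controls
    (hbd : ∀ t ∈ Set.Icc (0:ℝ) T, 0 ≤ y t 0 ∧ 0 ≤ y t 1) :
    T ≥ 1 / Real.pi ^ 2 * Real.log (y₀ / y₁) := by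
  have hslice : ∀ f : ℝ → ℝ → ℝ,
      ContinuousOn (fun q : ℝ × ℝ => f q.1 q.2) (Set.Icc 0 T ×ˢ Set.Icc 0 1) →
      ∀ t ∈ Set.Icc (0:ℝ) T, ContinuousOn (fun x => f t x * Real.sin (Real.pi * x)) (Set.Icc 0 1) := by
    intro f hf t ht
    refine ContinuousOn.mul ?_ (by fun_prop)
    exact hf.comp (f := fun x : ℝ => (t, x)) (by fun_prop) (fun x hx => ⟨ht, hx⟩)
  have hint : ∀ f : ℝ → ℝ → ℝ,
      ContinuousOn (fun q : ℝ × ℝ => f q.1 q.2) (Set.Icc 0 T ×ˢ Set.Icc 0 1) →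
      ∀ t ∈ Set.Icc (0:ℝ) T,
        IntervalIntegrable (fun x => f t x * Real.sin (Real.pi * x)) MeasureTheory.volume 0 1 := by
    intro f hf t ht
    apply ContinuousOn.intervalIntegrable
    rw [Set.uIcc_of_le zero_le_one]
    exact hslice f hf t ht
  have hbound : ∀ f : ℝ → ℝ → ℝ,
      ContinuousOn (fun q : ℝ × ℝ => f q.1 q.2) (Set.Icc 0 T ×ˢ Set.Icc 0 1) →
      ∃ C : ℝ, ∀ t ∈ Set.Icc (0:ℝ) T, ∀ x ∈ Set.Icc (0:ℝ) 1,
        ‖f t x * Real.sin (Real.pi * x)‖ ≤ C := by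
    intro f hf
    obtain ⟨C, hC⟩ := (isCompact_Icc.prod isCompact_Icc).exists_bound_of_continuousOn hf
    refine ⟨C, fun t ht x hx => ?_⟩
    have h1 := hC (t, x) ⟨ht, hx⟩
    rw [norm_mul]
    have h2 : ‖Real.sin (Real.pi * x)‖ ≤ 1 := Real.abs_sin_le_one _
    calc _ ≤ ‖f t x‖ * 1 := by gcongr
      _ ≤ C := by simpa using h1
  have hIoc : ∀ x ∈ Set.uIoc (0:ℝ) 1, x ∈ Set.Icc (0:ℝ) 1 := by
    intro x hx
    rw [Set.uIoc_of_le zero_le_one] at hx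
    exact ⟨hx.1.le, hx.2⟩
  set J : ℝ → ℝ := fun t => ∫ x in (0:ℝ)..1, y t x * Real.sin (Real.pi * x) with hJ
  have hJcont : ContinuousOn J (Set.Icc 0 T) := by
    obtain ⟨C, hC⟩ := hbound y hy_cont
    intro t ht
    refine intervalIntegral.continuousWithinAt_of_dominated_interval (bound := fun _ => C) ?_ ?_ ?_ ?_
    · filter_upwards [self_mem_nhdsWithin] with s hs
      exact (hint y hy_cont s hs).def'.aestronglyMeasurable
    · filter_upwards [self_mem_nhdsWithin] with s hs
      exact Filter.Eventually.of_forall fun x hx => hC s hs x (hIoc x hx)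
    · simp
    · refine Filter.Eventually.of_forall fun x hx => ?_
      exact ((hyt t ht x (hIoc x hx)).continuousAt.continuousWithinAt).mul continuousWithinAt_const
  have hJder : ∀ t ∈ Set.Ioo (0:ℝ) T,
      HasDerivAt J (∫ x in (0:ℝ)..1, yt t x * Real.sin (Real.pi * x)) t := by
    obtain ⟨C, hC⟩ := hbound yt hyt_cont
    intro t ht
    have hn : Set.Ioo (0:ℝ) T ∈ nhds t := Ioo_mem_nhds ht.1 ht.2
    refine (intervalIntegral.hasDerivAt_integral_of_dominated_loc_of_deriv_le
      (F := fun t x => y t x * Real.sin (Real.pi * x))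
      (F' := fun t x => yt t x * Real.sin (Real.pi * x))
      (bound := fun _ => C) (s := Set.Ioo 0 T) hn ?_ ?_ ?_ ?_ ?_ ?_).2
    · filter_upwards [hn] with s hs
      exact (hint y hy_cont s ⟨hs.1.le, hs.2.le⟩).def'.aestronglyMeasurable
    · exact hint y hy_cont t ⟨ht.1.le, ht.2.le⟩
    · exact (hint yt hyt_cont t ⟨ht.1.le, ht.2.le⟩).def'.aestronglyMeasurable
    · exact Filter.Eventually.of_forall fun x hx s hs => hC s ⟨hs.1.le, hs.2.le⟩ x (hIoc x hx)
    · simp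
    · exact Filter.Eventually.of_forall fun x hx s hs =>
        (hyt s ⟨hs.1.le, hs.2.le⟩ x (hIoc x hx)).mul_const _
  have hparts : ∀ t ∈ Set.Icc (0:ℝ) T,
      (∫ x in (0:ℝ)..1, yt t x * Real.sin (Real.pi * x)) + Real.pi ^ 2 * J t
        = Real.pi * (y t 0 + y t 1) := by
    intro t ht
    have i1 := hint yt hyt_cont t ht
    have i2 := (hint y hy_cont t ht).const_mul (Real.pi ^ 2)
    rw [hJ]
    simp only
    rw [← intervalIntegral.integral_const_mul, ← intervalIntegral.integral_add i1 i2]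
    rw [intervalIntegral.integral_eq_sub_of_hasDerivAt
      (f := fun x => yx t x * Real.sin (Real.pi * x) - Real.pi * (y t x * Real.cos (Real.pi * x)))
      ?_ (i1.add i2)]
    · simp
      ring
    · intro x hx
      rw [Set.uIcc_of_le zero_le_one] at hx
      have hl : HasDerivAt (fun x : ℝ => Real.pi * x) Real.pi x := by
        simpa using (hasDerivAt_id x).const_mul Real.pi
      have := ((hyxx t ht x hx).mul hl.sin).sub
        (((hyx t ht x hx).mul hl.cos).const_mul Real.pi)
      refine this.congr_deriv ?_
      rw [heq t ht x hx]
      ring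
  have hmono : MonotoneOn (fun t => Real.exp (Real.pi ^ 2 * t) * J t) (Set.Icc 0 T) := by
    have hder : ∀ t ∈ Set.Ioo (0:ℝ) T, HasDerivAt (fun t => Real.exp (Real.pi ^ 2 * t) * J t)
        (Real.exp (Real.pi ^ 2 * t) * (Real.pi * (y t 0 + y t 1))) t := by
      intro t ht
      have hl : HasDerivAt (fun x : ℝ => Real.pi ^ 2 * x) (Real.pi ^ 2) t := by
        simpa using (hasDerivAt_id t).const_mul (Real.pi ^ 2)
      refine (hl.exp.mul (hJder t ht)).congr_deriv ?_
      rw [← hparts t ⟨ht.1.le, ht.2.le⟩]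
      ring
    apply monotoneOn_of_deriv_nonneg (convex_Icc 0 T)
    · exact ContinuousOn.mul (by fun_prop) hJcont
    · rw [interior_Icc]
      exact fun t ht => (hder t ht).differentiableAt.differentiableWithinAt
    · rw [interior_Icc]
      intro t ht
      rw [(hder t ht).deriv]
      have hb := hbd t ⟨ht.1.le, ht.2.le⟩
      have := Real.pi_pos
      have := add_nonneg hb.1 hb.2
      positivity
  have hconst : ∀ t c : ℝ, (∀ x ∈ Set.Icc (0:ℝ) 1, y t x = c) →
      J t = c * ∫ x in (0:ℝ)..1, Real.sin (Real.pi * x) := by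
    intro t c h
    rw [← intervalIntegral.integral_const_mul]
    apply intervalIntegral.integral_congr
    intro x hx
    rw [Set.uIcc_of_le zero_le_one] at hx
    simp only [h x hx]
  have hS : 0 < ∫ x in (0:ℝ)..1, Real.sin (Real.pi * x) := by
    apply intervalIntegral.intervalIntegral_pos_of_pos_on
    · exact Continuous.intervalIntegrable (by fun_prop) _ _
    · intro x hx
      apply Real.sin_pos_of_pos_of_lt_pi
      · exact mul_pos Real.pi_pos hx.1
      · nlinarith [Real.pi_pos, hx.2]
    · exact zero_lt_one
  have hm := hmono ⟨le_refl 0, hT.le⟩ ⟨hT.le, le_refl T⟩ hT.le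
  simp only [mul_zero, Real.exp_zero, one_mul, hconst 0 y₀ hinit, hconst T y₁ hfin] at hm
  rw [← mul_assoc] at hm
  have hm2 : y₀ ≤ Real.exp (Real.pi ^ 2 * T) * y₁ := le_of_mul_le_mul_right hm hS
  have hlog : Real.log (y₀ / y₁) ≤ Real.pi ^ 2 * T := by
    rw [Real.log_le_iff_le_exp (div_pos (hy₁.trans hy) hy₁), div_le_iff₀ hy₁]
    exact hm2
  have hp : 0 < Real.pi ^ 2 := by have := Real.pi_pos; positivity
  rw [ge_iff_le, one_div, inv_mul_le_iff₀ hp]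
  exact hlog
end

section
/- Let λ > π² and T > 0. Suppose y : ℝ × ℝ → ℝ is such that y and its partial derivatives ∂ₜy, ∂ₓy, ∂ₓ²y exist and are continuous on [0,T] × [0,1], ∂ₜy(t,x) = ∂ₓ²y(t,x) + λ y(t,x) for all (t,x) ∈ [0,T] × [0,1], y(0,x) = sin(πx) for all x ∈ [0,1], and y(t,0) ≥ 0 and y(t,1) ≥ 0 for all t ∈ [0,T]. Then ∫₀¹ y(T,x) sin(πx) dx ≥ (1/2) e^{(λ−π²)T}. -/
theorem stmt8 (lam T : ℝ) (hlam : Real.pi ^ 2 < lam) (hT : 0 < T)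
    (y yt yx yxx : ℝ → ℝ → ℝ)
    -- `y` and all its partial derivatives are continuous on `[0,T] × [0,1]`
    (hy_cont : ContinuousOn (fun q : ℝ × ℝ => y q.1 q.2) (Set.Icc 0 T ×ˢ Set.Icc 0 1))
    (hyt_cont : ContinuousOn (fun q : ℝ × ℝ => yt q.1 q.2) (Set.Icc 0 T ×ˢ Set.Icc 0 1))
    (hyx_cont : ContinuousOn (fun q : ℝ × ℝ => yx q.1 q.2) (Set.Icc 0 T ×ˢ Set.Icc 0 1))
    (hyxx_cont : ContinuousOn (fun q : ℝ × ℝ => yxx q.1 q.2) (Set.Icc 0 T ×ˢ Set.Icc 0 1))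
    -- the partial derivatives exist on `[0,T] × [0,1]`
    (hyt : ∀ t ∈ Set.Icc (0:ℝ) T, ∀ x ∈ Set.Icc (0:ℝ) 1,
      HasDerivAt (fun s => y s x) (yt t x) t)
    (hyx : ∀ t ∈ Set.Icc (0:ℝ) T, ∀ x ∈ Set.Icc (0:ℝ) 1,
      HasDerivAt (fun x' => y t x') (yx t x) x)
    (hyxx : ∀ t ∈ Set.Icc (0:ℝ) T, ∀ x ∈ Set.Icc (0:ℝ) 1,
      HasDerivAt (fun x' => yx t x') (yxx t x) x)
    -- `y` solves `y_t = y_xx + λ y`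
    (heq : ∀ t ∈ Set.Icc (0:ℝ) T, ∀ x ∈ Set.Icc (0:ℝ) 1, yt t x = yxx t x + lam * y t x)
    -- initial datum: the first Dirichlet eigenfunction
    (hinit : ∀ x ∈ Set.Icc (0:ℝ) 1, y 0 x = Real.sin (Real.pi * x))
    -- nonnegative boundary controls
    (hbd : ∀ t ∈ Set.Icc (0:ℝ) T, 0 ≤ y t 0 ∧ 0 ≤ y t 1) :
    (1/2) * Real.exp ((lam - Real.pi ^ 2) * T)
      ≤ ∫ x in (0:ℝ)..1, y T x * Real.sin (Real.pi * x) := by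
  have hsin : Continuous (fun x : ℝ => Real.sin (Real.pi * x)) := by fun_prop
  have slice : ∀ f : ℝ → ℝ → ℝ,
      ContinuousOn (fun q : ℝ × ℝ => f q.1 q.2) (Set.Icc 0 T ×ˢ Set.Icc 0 1) →
      ∀ t ∈ Set.Icc (0:ℝ) T,
        ContinuousOn (fun x => f t x * Real.sin (Real.pi * x)) (Set.Icc 0 1) := by
    intro f hf t ht
    refine ContinuousOn.mul ?_ hsin.continuousOn
    exact hf.comp (f := fun x : ℝ => (t, x)) (by fun_prop) (fun x hx => ⟨ht, hx⟩)
  have sint : ∀ f : ℝ → ℝ → ℝ,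
      ContinuousOn (fun q : ℝ × ℝ => f q.1 q.2) (Set.Icc 0 T ×ˢ Set.Icc 0 1) →
      ∀ t ∈ Set.Icc (0:ℝ) T,
        IntervalIntegrable (fun x => f t x * Real.sin (Real.pi * x)) MeasureTheory.volume 0 1 := by
    intro f hf t ht
    apply ContinuousOn.intervalIntegrable
    rw [Set.uIcc_of_le zero_le_one]
    exact slice f hf t ht
  have sbd : ∀ f : ℝ → ℝ → ℝ,
      ContinuousOn (fun q : ℝ × ℝ => f q.1 q.2) (Set.Icc 0 T ×ˢ Set.Icc 0 1) →
      ∃ C, ∀ t ∈ Set.Icc (0:ℝ) T, ∀ x ∈ Set.Icc (0:ℝ) 1,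
        ‖f t x * Real.sin (Real.pi * x)‖ ≤ C := by
    intro f hf
    obtain ⟨C, hC⟩ := (isCompact_Icc.prod isCompact_Icc).exists_bound_of_continuousOn hf
    refine ⟨C, fun t ht x hx => ?_⟩
    have h1 := hC (t, x) ⟨ht, hx⟩
    have h2 := Real.abs_sin_le_one (Real.pi * x)
    rw [norm_mul]
    calc _ ≤ ‖f t x‖ * 1 := by gcongr; exact h2
      _ ≤ C := by simpa using h1
  have hio : ∀ x ∈ Set.uIoc (0:ℝ) 1, x ∈ Set.Icc (0:ℝ) 1 := by
    intro x hx
    rw [Set.uIoc_of_le zero_le_one] at hx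
    exact ⟨hx.1.le, hx.2⟩
  set M : ℝ → ℝ := fun t => ∫ x in (0:ℝ)..1, y t x * Real.sin (Real.pi * x) with hM
  set c := lam - Real.pi ^ 2 with hc
  have hMc : ContinuousOn M (Set.Icc 0 T) := by
    intro t ht
    obtain ⟨C, hC⟩ := sbd y hy_cont
    refine intervalIntegral.continuousWithinAt_of_dominated_interval (bound := fun _ => C) ?_ ?_ ?_ ?_
    · filter_upwards [self_mem_nhdsWithin] with s hs
      have := (sint y hy_cont s hs).aestronglyMeasurable
      rwa [Set.uIoc_of_le zero_le_one]
    · filter_upwards [self_mem_nhdsWithin] with s hs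
      exact Filter.Eventually.of_forall fun x hx => hC s hs x (hio x hx)
    · exact intervalIntegrable_const
    · refine Filter.Eventually.of_forall fun x hx => ?_
      exact ((hyt t ht x (hio x hx)).continuousAt.mul continuousAt_const).continuousWithinAt
  have hMd : ∀ t ∈ Set.Ioo (0:ℝ) T,
      HasDerivAt M (∫ x in (0:ℝ)..1, yt t x * Real.sin (Real.pi * x)) t := by
    intro t ht
    obtain ⟨C, hC⟩ := sbd yt hyt_cont
    have ht' := Set.Ioo_subset_Icc_self ht
    refine (intervalIntegral.hasDerivAt_integral_of_dominated_loc_of_deriv_le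
      (F := fun t x => y t x * Real.sin (Real.pi * x))
      (F' := fun t x => yt t x * Real.sin (Real.pi * x)) (s := Set.Ioo 0 T)
      (bound := fun _ => C) (isOpen_Ioo.mem_nhds ht) ?_ (sint y hy_cont t ht') ?_ ?_ ?_ ?_).2
    · filter_upwards [isOpen_Ioo.mem_nhds ht] with s hs
      have := (sint y hy_cont s (Set.Ioo_subset_Icc_self hs)).aestronglyMeasurable
      rwa [Set.uIoc_of_le zero_le_one]
    · have := (sint yt hyt_cont t ht').aestronglyMeasurable
      rwa [Set.uIoc_of_le zero_le_one]
    · exact Filter.Eventually.of_forall fun x hx s hs =>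
        hC s (Set.Ioo_subset_Icc_self hs) x (hio x hx)
    · exact intervalIntegrable_const
    · exact Filter.Eventually.of_forall fun x hx s hs =>
        (hyt s (Set.Ioo_subset_Icc_self hs) x (hio x hx)).mul_const _
  have hge : ∀ t ∈ Set.Icc (0:ℝ) T,
      c * M t ≤ ∫ x in (0:ℝ)..1, yt t x * Real.sin (Real.pi * x) := by
    intro t ht
    have i1 := sint yt hyt_cont t ht
    have i2 := (sint y hy_cont t ht).const_mul c
    have key : ∫ x in (0:ℝ)..1, (yt t x * Real.sin (Real.pi * x)
        - c * (y t x * Real.sin (Real.pi * x)))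
        = (yx t 1 * Real.sin (Real.pi * 1) - Real.pi * (y t 1 * Real.cos (Real.pi * 1)))
        - (yx t 0 * Real.sin (Real.pi * 0) - Real.pi * (y t 0 * Real.cos (Real.pi * 0))) := by
      refine intervalIntegral.integral_eq_sub_of_hasDerivAt
        (f := fun x => yx t x * Real.sin (Real.pi * x)
          - Real.pi * (y t x * Real.cos (Real.pi * x))) ?_ (i1.sub i2)
      intro x hx
      rw [Set.uIcc_of_le zero_le_one] at hx
      have hl : HasDerivAt (fun x : ℝ => Real.pi * x) Real.pi x := by
        simpa using (hasDerivAt_id x).const_mul Real.pi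
      have h := ((hyxx t ht x hx).mul hl.sin).sub
        (((hyx t ht x hx).mul hl.cos).const_mul Real.pi)
      refine HasDerivAt.congr_deriv h ?_
      rw [heq t ht x hx, hc]
      ring
    rw [intervalIntegral.integral_sub i1 i2, intervalIntegral.integral_const_mul] at key
    simp only [mul_one, mul_zero, Real.sin_pi, Real.cos_pi, Real.sin_zero, Real.cos_zero] at key
    have h0 := mul_nonneg Real.pi_pos.le (hbd t ht).1
    have h1 := mul_nonneg Real.pi_pos.le (hbd t ht).2
    simp only [hM]
    linarith
  have hM0 : M 0 = 1 / 2 := by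
    have e : M 0 = ∫ x in (0:ℝ)..1, Real.sin (Real.pi * x) ^ 2 := by
      refine intervalIntegral.integral_congr fun x hx => ?_
      rw [Set.uIcc_of_le zero_le_one] at hx
      simp only [hinit x hx, sq]
    rw [e, intervalIntegral.integral_comp_mul_left (fun x => Real.sin x ^ 2) Real.pi_ne_zero,
      integral_sin_sq]
    have := Real.pi_ne_zero
    simp
    field_simp
  have hmono : MonotoneOn (fun t => Real.exp (-c * t) * M t) (Set.Icc 0 T) := by
    have hd : ∀ t ∈ Set.Ioo (0:ℝ) T, HasDerivAt (fun t => Real.exp (-c * t) * M t)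
        (Real.exp (-c * t) * (-c) * M t
          + Real.exp (-c * t) * ∫ x in (0:ℝ)..1, yt t x * Real.sin (Real.pi * x)) t := by
      intro t ht
      have hl : HasDerivAt (fun t : ℝ => -c * t) (-c) t := by
        simpa using (hasDerivAt_id t).const_mul (-c)
      exact hl.exp.mul (hMd t ht)
    refine monotoneOn_of_deriv_nonneg (convex_Icc 0 T) ?_ ?_ ?_
    · exact ContinuousOn.mul (by fun_prop) hMc
    · rw [interior_Icc]
      exact fun t ht => (hd t ht).differentiableAt.differentiableWithinAt
    · rw [interior_Icc]
      intro t ht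
      rw [(hd t ht).deriv]
      have h1 := hge t (Set.Ioo_subset_Icc_self ht)
      have h2 := mul_nonneg (Real.exp_pos (-c * t)).le (sub_nonneg.2 h1)
      linarith
  have hfin := hmono (Set.left_mem_Icc.2 hT.le) (Set.right_mem_Icc.2 hT.le) hT.le
  simp only [mul_zero, Real.exp_zero, one_mul, hM0] at hfin
  have h3 := mul_le_mul_of_nonneg_right hfin (Real.exp_pos (c * T)).le
  have h4 : Real.exp (-c * T) * Real.exp (c * T) = 1 := by
    rw [← Real.exp_add]; simp
  calc _ ≤ _ := h3
    _ = (Real.exp (-c * T) * Real.exp (c * T)) * M T := by ring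
    _ = M T := by rw [h4, one_mul]
end

section
/- For any constants y₀ > 0 and y₁ > 0 there exist T > 0 and a function y : ℝ × ℝ → ℝ such that: y and its partial derivatives ∂ₜy, ∂ₓy, ∂ₓ²y exist and are continuous on [0,T] × [0,1]; ∂ₜy(t,x) = ∂ₓ²y(t,x) for all (t,x) ∈ [0,T] × [0,1]; y(0,x) = y₀ and y(T,x) = y₁ for all x ∈ [0,1]; the boundary controls are nonnegative, i.e. y(t,0) ≥ 0 and y(t,1) ≥ 0 for all t ∈ [0,T]; and moreover the state is nonnegative everywhere: y(t,x) ≥ 0 for all (t,x) ∈ [0,T] × [0,1]. -/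
/-- `t^(-j) exp(-1/t)` extended by zero. -/
noncomputable def hfun (j : ℕ) (t : ℝ) : ℝ :=
  if t ≤ 0 then 0 else (t⁻¹) ^ j * Real.exp (-t⁻¹)

lemma hfun_nonneg (j : ℕ) (t : ℝ) : 0 ≤ hfun j t := by
  unfold hfun
  split_ifs with h
  · exact le_rfl
  · push Not at h
    positivity

lemma hfun_le (j : ℕ) (t : ℝ) : hfun j t ≤ (j.factorial : ℝ) := by
  unfold hfun
  split_ifs with h
  · positivity
  · push Not at h
    have h1 := Real.pow_div_factorial_le_exp (x := t⁻¹) (by positivity) j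
    have hj : (0:ℝ) < j.factorial := by positivity
    rw [div_le_iff₀ hj] at h1
    calc (t⁻¹) ^ j * Real.exp (-t⁻¹)
        ≤ (Real.exp t⁻¹ * j.factorial) * Real.exp (-t⁻¹) := by gcongr
      _ = (Real.exp t⁻¹ * Real.exp (-t⁻¹)) * j.factorial := by ring
      _ = j.factorial := by rw [← Real.exp_add]; simp

lemma hfun_of_nonpos (j : ℕ) {t : ℝ} (h : t ≤ 0) : hfun j t = 0 := by
  simp [hfun, h]

lemma hfun_sq (j : ℕ) (t : ℝ) : hfun j t = t ^ 2 * hfun (j + 2) t := by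
  unfold hfun
  split_ifs with h
  · simp
  · push Not at h
    have : t * t⁻¹ = 1 := mul_inv_cancel₀ h.ne'
    calc t⁻¹ ^ j * Real.exp (-t⁻¹) = (t * t⁻¹) ^ 2 * (t⁻¹ ^ j * Real.exp (-t⁻¹)) := by
          rw [this]; ring
      _ = _ := by ring

lemma hfun_hasDerivAt (j : ℕ) (t : ℝ) :
    HasDerivAt (hfun j) (hfun (j + 2) t - j * hfun (j + 1) t) t := by
  rcases lt_trichotomy t 0 with h | h | h
  · rw [hfun_of_nonpos _ h.le, hfun_of_nonpos _ h.le]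
    have : hfun j =ᶠ[nhds t] fun _ => 0 := by
      filter_upwards [Iio_mem_nhds h] with s hs
      exact hfun_of_nonpos _ (le_of_lt hs)
    simpa using (hasDerivAt_const t (0:ℝ)).congr_of_eventuallyEq this
  · subst h
    rw [hfun_of_nonpos _ le_rfl, hfun_of_nonpos _ le_rfl]
    rw [hasDerivAt_iff_isLittleO]
    simp only [hfun_of_nonpos _ le_rfl, sub_zero, mul_zero, smul_zero]
    have h1 : (hfun j) =O[nhds 0] (fun t : ℝ => t ^ 2) := by
      refine Asymptotics.IsBigO.of_bound ((j + 2).factorial : ℝ) (Filter.Eventually.of_forall ?_)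
      intro s
      rw [hfun_sq, norm_mul, mul_comm]
      gcongr
      rw [Real.norm_of_nonneg (hfun_nonneg _ _)]
      exact hfun_le _ _
    refine h1.trans_isLittleO ?_
    have := Asymptotics.isLittleO_pow_pow (𝕜 := ℝ) (m := 1) (n := 2) (by norm_num)
    simpa using this
  · have e : hfun j =ᶠ[nhds t] fun t => (t⁻¹) ^ j * Real.exp (-t⁻¹) := by
      filter_upwards [Ioi_mem_nhds h] with s hs
      simp [hfun, not_le.mpr (Set.mem_Ioi.mp hs)]
    have hi := hasDerivAt_inv h.ne'
    have h2 := (hi.pow j).mul hi.neg.exp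
    refine (h2.congr_of_eventuallyEq e).congr_deriv ?_
    simp only [hfun, not_le.mpr h, if_false]
    rcases j with _ | j
    · simp
      field_simp
    · simp
      field_simp
      ring

/-- Iterated derivatives of the bump `hfun i t * hfun j (1-t)`. -/
noncomputable def Gf : ℕ → ℕ → ℕ → ℝ → ℝ
  | 0, i, j, t => hfun i t * hfun j (1 - t)
  | n + 1, i, j, t => Gf n (i + 2) j t - i * Gf n (i + 1) j t - Gf n i (j + 2) t
      + j * Gf n i (j + 1) t

lemma Gf_hasDerivAt (n : ℕ) : ∀ (i j : ℕ) (t : ℝ),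
    HasDerivAt (Gf n i j) (Gf (n + 1) i j t) t := by
  induction n with
  | zero =>
    intro i j t
    have h1 := hfun_hasDerivAt i t
    have h2 := (hfun_hasDerivAt j (1 - t)).comp t ((hasDerivAt_id t).const_sub 1)
    have h3 := h1.mul h2
    have e : Gf 0 i j = hfun i * (hfun j ∘ fun t => 1 - id t) := by
      funext s; simp [Gf]
    rw [e]
    refine h3.congr_deriv ?_
    simp [Gf]
    ring
  | succ n ih =>
    intro i j t
    have := (((ih (i + 2) j t).sub ((ih (i + 1) j t).const_mul (i : ℝ))).sub
      (ih i (j + 2) t)).add ((ih i (j + 1) t).const_mul (j : ℝ))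
    exact this

lemma Gf_zero (n : ℕ) : ∀ (i j : ℕ) (t : ℝ), (t ≤ 0 ∨ 1 ≤ t) → Gf n i j t = 0 := by
  induction n with
  | zero =>
    intro i j t h
    rcases h with h | h
    · simp [Gf, hfun_of_nonpos _ h]
    · simp [Gf, hfun_of_nonpos j (sub_nonpos.mpr h)]
  | succ n ih =>
    intro i j t h
    simp [Gf, ih _ _ t h]

lemma Gf_bound (n : ℕ) : ∀ (i j : ℕ) (t : ℝ),
    |Gf n i j t| ≤ 4 ^ n * ((i + j + 2 * n).factorial : ℝ) := by
  induction n with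
  | zero =>
    intro i j t
    simp only [Gf, pow_zero, one_mul, mul_zero, add_zero]
    rw [abs_mul, abs_of_nonneg (hfun_nonneg _ _), abs_of_nonneg (hfun_nonneg _ _)]
    calc _ ≤ (i.factorial : ℝ) * j.factorial :=
          mul_le_mul (hfun_le _ _) (hfun_le _ _) (hfun_nonneg _ _) (by positivity)
      _ ≤ ((i + j).factorial : ℝ) := by
          exact_mod_cast Nat.le_of_dvd (Nat.factorial_pos _) (Nat.factorial_mul_factorial_dvd_factorial_add i j)
  | succ n ih =>
    intro i j t
    have h1 := ih (i + 2) j t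
    have h2 := ih (i + 1) j t
    have h3 := ih i (j + 2) t
    have h4 := ih i (j + 1) t
    have e1 : i + 2 + j + 2 * n = i + j + 2 * (n + 1) := by ring
    have e3 : i + (j + 2) + 2 * n = i + j + 2 * (n + 1) := by ring
    have e2 : i + 1 + j + 2 * n = i + j + 2 * n + 1 := by ring
    have e4 : i + (j + 1) + 2 * n = i + j + 2 * n + 1 := by ring
    have e5 : i + j + 2 * (n + 1) = (i + j + 2 * n + 1) + 1 := by ring
    rw [e1] at h1
    rw [e2] at h2
    rw [e3] at h3
    rw [e4] at h4
    have hf : ((i + j + 2 * (n + 1)).factorial : ℝ)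
        = (i + j + 2 * n + 2) * ((i + j + 2 * n + 1).factorial : ℝ) := by
      rw [e5, Nat.factorial_succ]; push_cast; ring
    set X : ℝ := ((i + j + 2 * (n + 1)).factorial : ℝ)
    set Y : ℝ := ((i + j + 2 * n + 1).factorial : ℝ)
    have hY : 0 ≤ Y := by positivity
    have hi : (i:ℝ) * |Gf n (i + 1) j t| ≤ 4 ^ n * X := by
      calc _ ≤ (i:ℝ) * (4 ^ n * Y) := by gcongr
        _ = 4 ^ n * (i * Y) := by ring
        _ ≤ 4 ^ n * X := by
          rw [hf]; gcongr
          have : (0:ℝ) ≤ j := by positivity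
          have : (0:ℝ) ≤ n := by positivity
          linarith
    have hj : (j:ℝ) * |Gf n i (j + 1) t| ≤ 4 ^ n * X := by
      calc _ ≤ (j:ℝ) * (4 ^ n * Y) := by gcongr
        _ = 4 ^ n * (j * Y) := by ring
        _ ≤ 4 ^ n * X := by
          rw [hf]; gcongr
          have : (0:ℝ) ≤ i := by positivity
          have : (0:ℝ) ≤ n := by positivity
          linarith
    have ai : |(i:ℝ) * Gf n (i + 1) j t| = (i:ℝ) * |Gf n (i + 1) j t| := by
      rw [abs_mul, Nat.abs_cast]
    have aj : |(j:ℝ) * Gf n i (j + 1) t| = (j:ℝ) * |Gf n i (j + 1) t| := by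
      rw [abs_mul, Nat.abs_cast]
    rw [← ai] at hi
    rw [← aj] at hj
    simp only [Gf]
    rw [pow_succ]
    rw [abs_le] at *
    constructor <;> linarith [h1.1, h1.2, h3.1, h3.2, hi.1, hi.2, hj.1, hj.2]

/-- The flatness series. -/
noncomputable def Es (c : ℕ → ℝ → ℝ) (r : ℕ) (t x : ℝ) : ℝ :=
  ∑' n, c n t * (x ^ (2 * n + r) / ((2 * n + r).factorial : ℝ))

section series

variable {c : ℕ → ℝ → ℝ} {M : ℝ}

lemma term_bound (hb : ∀ n t, |c n t| ≤ M * (1 / 8) ^ n * ((2 * n).factorial : ℝ))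
    (r : ℕ) (hr : r ≤ 2) (n : ℕ) (t x : ℝ) (hx : |x| ≤ 2) :
    ‖c n t * (x ^ (2 * n + r) / ((2 * n + r).factorial : ℝ))‖ ≤ 4 * M * (1 / 2) ^ n := by
  have hM : 0 ≤ M := by
    have := (abs_nonneg _).trans (hb 0 0)
    simpa using this
  rw [Real.norm_eq_abs, abs_mul, abs_div, abs_pow, Nat.abs_cast]
  have h1 : |x| ^ (2 * n + r) ≤ 4 ^ n * 4 := by
    calc |x| ^ (2 * n + r) ≤ 2 ^ (2 * n + r) := by gcongr
      _ = 4 ^ n * 2 ^ r := by rw [pow_add, pow_mul]; norm_num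
      _ ≤ 4 ^ n * 2 ^ 2 := by gcongr; norm_num
      _ = _ := by norm_num
  have h2 : ((2 * n).factorial : ℝ) ≤ ((2 * n + r).factorial : ℝ) := by
    exact_mod_cast Nat.factorial_le (by omega)
  have hp : (0:ℝ) < ((2 * n).factorial : ℝ) := by positivity
  calc |c n t| * (|x| ^ (2 * n + r) / ((2 * n + r).factorial : ℝ))
      ≤ (M * (1 / 8) ^ n * ((2 * n).factorial : ℝ)) * ((4 ^ n * 4) / ((2 * n).factorial : ℝ)) := by
        gcongr
        exact hb n t
    _ = 4 * M * ((1 / 8) ^ n * 4 ^ n) := by field_simp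
    _ = 4 * M * (1 / 2) ^ n := by rw [← mul_pow]; norm_num

lemma sum_geo : Summable (fun n : ℕ => 4 * M * (1 / 2 : ℝ) ^ n) :=
  (summable_geometric_of_lt_one (by norm_num) (by norm_num)).mul_left _

lemma term_summable (hb : ∀ n t, |c n t| ≤ M * (1 / 8) ^ n * ((2 * n).factorial : ℝ))
    (r : ℕ) (hr : r ≤ 2) (t x : ℝ) (hx : |x| ≤ 2) :
    Summable (fun n => c n t * (x ^ (2 * n + r) / ((2 * n + r).factorial : ℝ))) :=
  Summable.of_norm_bounded sum_geo (fun n => term_bound hb r hr n t x hx)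

lemma Es_bound (hb : ∀ n t, |c n t| ≤ M * (1 / 8) ^ n * ((2 * n).factorial : ℝ))
    (r : ℕ) (hr : r ≤ 2) (t x : ℝ) (hx : |x| ≤ 2) : |Es c r t x| ≤ 8 * M := by
  have h : HasSum (fun n : ℕ => 4 * M * (1 / 2 : ℝ) ^ n) (4 * M * 2) :=
    hasSum_geometric_two.mul_left _
  have := tsum_of_norm_bounded h (fun n => term_bound hb r hr n t x hx)
  rw [Real.norm_eq_abs] at this
  unfold Es
  linarith

lemma Es_cont (hb : ∀ n t, |c n t| ≤ M * (1 / 8) ^ n * ((2 * n).factorial : ℝ))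
    (hc : ∀ n, Continuous (c n)) (r : ℕ) (hr : r ≤ 2) (S : Set ℝ) :
    ContinuousOn (fun q : ℝ × ℝ => Es c r q.1 q.2) (S ×ˢ Set.Icc 0 1) := by
  unfold Es
  refine continuousOn_tsum (u := fun n : ℕ => 4 * M * (1 / 2 : ℝ) ^ n) ?_ sum_geo ?_
  · intro n
    have := hc n
    fun_prop
  · rintro n ⟨t, x⟩ ⟨_, hx⟩
    exact term_bound hb r hr n t x (abs_le.mpr ⟨by linarith [hx.1], by linarith [hx.2]⟩)

lemma Es_deriv_x (hb : ∀ n t, |c n t| ≤ M * (1 / 8) ^ n * ((2 * n).factorial : ℝ))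
    (r : ℕ) (hr : r ≤ 1) (t x : ℝ) (hx : x ∈ Set.Icc (0:ℝ) 1) :
    HasDerivAt (fun x' => Es c (r + 1) t x') (Es c r t x) x := by
  unfold Es
  have hab : ∀ z ∈ Set.Ioo (-2:ℝ) 2, |z| ≤ 2 := fun z hz => abs_le.mpr ⟨hz.1.le, hz.2.le⟩
  have hx2 : x ∈ Set.Ioo (-2:ℝ) 2 := ⟨by linarith [hx.1], by linarith [hx.2]⟩
  refine hasDerivAt_tsum_of_isPreconnected (𝕜 := ℝ) (F := ℝ)
    (g := fun n x => c n t * (x ^ (2 * n + (r + 1)) / ((2 * n + (r + 1)).factorial : ℝ)))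
    (g' := fun n x => c n t * (x ^ (2 * n + r) / ((2 * n + r).factorial : ℝ))) (u := fun n : ℕ => 4 * M * (1 / 2 : ℝ) ^ n)
    (t := Set.Ioo (-2:ℝ) 2) (y₀ := x) sum_geo isOpen_Ioo isPreconnected_Ioo ?_ ?_ hx2 ?_ hx2
  · intro n z hz
    have := ((hasDerivAt_pow (2 * n + (r + 1)) z).div_const
      ((2 * n + (r + 1)).factorial : ℝ)).const_mul (c n t)
    refine this.congr_deriv ?_
    have e : 2 * n + (r + 1) = (2 * n + r) + 1 := by ring
    rw [e, Nat.factorial_succ]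
    push_cast
    have h1 : ((2 * n + r).factorial : ℝ) ≠ 0 := by positivity
    have h2 : (2 * (n:ℝ) + r + 1) ≠ 0 := by positivity
    field_simp
  · intro n z hz
    exact term_bound hb r (by omega) n t z (hab z hz)
  · exact term_summable hb (r + 1) (by omega) t x (hab x hx2)

lemma Es_deriv_t (hb : ∀ n t, |c n t| ≤ M * (1 / 8) ^ n * ((2 * n).factorial : ℝ))
    (hd : ∀ n t, HasDerivAt (c n) (c (n + 1) t) t) (t x : ℝ) (hx : x ∈ Set.Icc (0:ℝ) 1) :
    HasDerivAt (fun s => Es c 2 s x) (Es c 0 t x - c 0 t) t := by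
  have hx2 : |x| ≤ 2 := abs_le.mpr ⟨by linarith [hx.1], by linarith [hx.2]⟩
  have e : Es c 0 t x - c 0 t
      = ∑' n, c (n + 1) t * (x ^ (2 * n + 2) / ((2 * n + 2).factorial : ℝ)) := by
    unfold Es
    rw [(term_summable hb 0 (by omega) t x hx2).tsum_eq_zero_add]
    simp [mul_add]
  rw [e]
  unfold Es
  refine hasDerivAt_tsum (𝕜 := ℝ) (F := ℝ)
    (g := fun n s => c n s * (x ^ (2 * n + 2) / ((2 * n + 2).factorial : ℝ)))
    (g' := fun n s => c (n + 1) s * (x ^ (2 * n + 2) / ((2 * n + 2).factorial : ℝ))) (u := fun n : ℕ => 4 * M * (1 / 2 : ℝ) ^ (n + 1)) (y₀ := t)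
    ((summable_nat_add_iff 1).mpr sum_geo) ?_ ?_ ?_ t
  · intro n s
    exact (hd n s).mul_const _
  · intro n s
    have := term_bound hb 0 (by omega) (n + 1) s x hx2
    simpa [mul_add] using this
  · exact term_summable hb 2 le_rfl t x hx2

end series

/-- Primitive of the bump. -/
noncomputable def Phi (t : ℝ) : ℝ := ∫ s in (0:ℝ)..t, Gf 0 0 0 s

lemma Gf_cont (n i j : ℕ) : Continuous (Gf n i j) :=
  continuous_iff_continuousAt.mpr fun t => (Gf_hasDerivAt n i j t).continuousAt

lemma Phi_hasDerivAt (t : ℝ) : HasDerivAt Phi (Gf 0 0 0 t) t :=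
  intervalIntegral.integral_hasDerivAt_right ((Gf_cont 0 0 0).intervalIntegrable _ _)
    ((Gf_cont 0 0 0).stronglyMeasurableAtFilter _ _) (Gf_cont 0 0 0).continuousAt

lemma Phi_mono : Monotone Phi :=
  monotone_of_deriv_nonneg (fun t => (Phi_hasDerivAt t).differentiableAt) (fun t => by
    rw [(Phi_hasDerivAt t).deriv]
    exact mul_nonneg (hfun_nonneg _ _) (hfun_nonneg _ _))

lemma Phi_zero : Phi 0 = 0 := by simp [Phi]

lemma Phi_one_pos : 0 < Phi 1 := by
  refine intervalIntegral.intervalIntegral_pos_of_pos_on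
    ((Gf_cont 0 0 0).intervalIntegrable _ _) ?_ one_pos
  intro x hx
  have h1 : ¬ x ≤ 0 := not_le.mpr hx.1
  have h2 : ¬ (1 - x ≤ 0) := by linarith [hx.2]
  simp only [Gf, hfun, h1, h2, if_false]
  have := Real.exp_pos (-x⁻¹)
  have := Real.exp_pos (-(1 - x)⁻¹)
  simp only [pow_zero, one_mul]
  positivity

theorem stmt10 (y₀ y₁ : ℝ) (hy₀ : 0 < y₀) (hy₁ : 0 < y₁) :
    ∃ T : ℝ, 0 < T ∧
    ∃ y yt yx yxx : ℝ → ℝ → ℝ,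
      -- `y` and all its partial derivatives are continuous on `[0,T] × [0,1]`
      ContinuousOn (fun q : ℝ × ℝ => y q.1 q.2) (Set.Icc 0 T ×ˢ Set.Icc 0 1) ∧
      ContinuousOn (fun q : ℝ × ℝ => yt q.1 q.2) (Set.Icc 0 T ×ˢ Set.Icc 0 1) ∧
      ContinuousOn (fun q : ℝ × ℝ => yx q.1 q.2) (Set.Icc 0 T ×ˢ Set.Icc 0 1) ∧
      ContinuousOn (fun q : ℝ × ℝ => yxx q.1 q.2) (Set.Icc 0 T ×ˢ Set.Icc 0 1) ∧
      -- the partial derivatives exist on `[0,T] × [0,1]`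
      (∀ t ∈ Set.Icc (0:ℝ) T, ∀ x ∈ Set.Icc (0:ℝ) 1,
        HasDerivAt (fun s => y s x) (yt t x) t) ∧
      (∀ t ∈ Set.Icc (0:ℝ) T, ∀ x ∈ Set.Icc (0:ℝ) 1,
        HasDerivAt (fun x' => y t x') (yx t x) x) ∧
      (∀ t ∈ Set.Icc (0:ℝ) T, ∀ x ∈ Set.Icc (0:ℝ) 1,
        HasDerivAt (fun x' => yx t x') (yxx t x) x) ∧
      -- `y` solves the heat equation
      (∀ t ∈ Set.Icc (0:ℝ) T, ∀ x ∈ Set.Icc (0:ℝ) 1, yt t x = yxx t x) ∧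
      -- constant initial and final data
      (∀ x ∈ Set.Icc (0:ℝ) 1, y 0 x = y₀) ∧
      (∀ x ∈ Set.Icc (0:ℝ) 1, y T x = y₁) ∧
      -- nonnegative boundary controls
      (∀ t ∈ Set.Icc (0:ℝ) T, 0 ≤ y t 0 ∧ 0 ≤ y t 1) ∧
      -- the state is nonnegative everywhere
      (∀ t ∈ Set.Icc (0:ℝ) T, ∀ x ∈ Set.Icc (0:ℝ) 1, 0 ≤ y t x) := by
  have hκ := Phi_one_pos
  set κ := Phi 1 with hκdef
  set D : ℝ := (y₁ - y₀) / κ with hD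
  have hm : 0 < min y₀ y₁ := lt_min hy₀ hy₁
  set m := min y₀ y₁ with hmdef
  set T : ℝ := 32 + 8 * |D| / m with hT
  have hq : 0 ≤ 8 * |D| / m := by positivity
  have hT32 : 32 ≤ T := by linarith
  have hT0 : 0 < T := by linarith
  set c : ℕ → ℝ → ℝ := fun n t => D * (1 / T) ^ (n + 1) * Gf n 0 0 (t / T) with hc
  set F : ℝ → ℝ := fun t => y₀ + D * Phi (t / T) with hF
  set M : ℝ := |D| / T with hMdef
  have hM8 : 8 * M ≤ m := by
    rw [hMdef, ← mul_div_assoc, div_le_iff₀ hT0]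
    have : m * T = m * 32 + 8 * |D| := by rw [hT]; field_simp
    nlinarith
  have hdiv : ∀ t : ℝ, HasDerivAt (fun s : ℝ => s / T) (1 / T) t := fun t =>
    (hasDerivAt_id t).div_const T
  have hd : ∀ n t, HasDerivAt (c n) (c (n + 1) t) t := by
    intro n t
    have h := ((Gf_hasDerivAt n 0 0 (t / T)).comp t (hdiv t)).const_mul (D * (1 / T) ^ (n + 1))
    refine h.congr_deriv ?_
    simp only [hc]
    ring
  have hFd : ∀ t, HasDerivAt F (c 0 t) t := by
    intro t
    have h := (((Phi_hasDerivAt (t / T)).comp t (hdiv t)).const_mul D).const_add y₀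
    refine h.congr_deriv ?_
    simp only [hc]
    ring
  have hb : ∀ n t, |c n t| ≤ M * (1 / 8) ^ n * ((2 * n).factorial : ℝ) := by
    intro n t
    have h1 := Gf_bound n 0 0 (t / T)
    simp only [zero_add] at h1
    have h2 : 1 / T * 4 ≤ 1 / 8 := by
      rw [div_mul_eq_mul_div, div_le_iff₀ hT0]; linarith
    have h3 : (1 / T) ^ n * 4 ^ n ≤ (1 / 8 : ℝ) ^ n := by
      rw [← mul_pow]
      gcongr
    simp only [hc]
    rw [abs_mul, abs_mul, abs_of_nonneg (by positivity : 0 ≤ (1 / T) ^ (n + 1))]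
    calc |D| * (1 / T) ^ (n + 1) * |Gf n 0 0 (t / T)|
        ≤ |D| * (1 / T) ^ (n + 1) * (4 ^ n * ((2 * n).factorial : ℝ)) := by gcongr
      _ = M * ((1 / T) ^ n * 4 ^ n) * ((2 * n).factorial : ℝ) := by rw [hMdef]; ring
      _ ≤ M * (1 / 8) ^ n * ((2 * n).factorial : ℝ) := by gcongr
  have hcc : ∀ n, Continuous (c n) := fun n =>
    continuous_iff_continuousAt.mpr fun t => (hd n t).continuousAt
  have hFc : Continuous F := continuous_iff_continuousAt.mpr fun t => (hFd t).continuousAt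
  have hE0 : ∀ t x, (t / T ≤ 0 ∨ 1 ≤ t / T) → Es c 2 t x = 0 := by
    intro t x h
    simp [Es, hc, Gf_zero _ 0 0 _ h]
  have hpos : ∀ t ∈ Set.Icc (0:ℝ) T, ∀ x ∈ Set.Icc (0:ℝ) 1, 0 ≤ F t + Es c 2 t x := by
    intro t ht x hx
    have h1 := Es_bound hb 2 le_rfl t x (abs_le.mpr ⟨by linarith [hx.1], by linarith [hx.2]⟩)
    have hp0 : 0 ≤ Phi (t / T) := by
      rw [← Phi_zero]; exact Phi_mono (div_nonneg ht.1 hT0.le)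
    have hp1 : Phi (t / T) ≤ κ := Phi_mono ((div_le_one hT0).mpr ht.2)
    have h2 : m ≤ F t := by
      have hθ0 : 0 ≤ Phi (t / T) / κ := by positivity
      have hθ1 : Phi (t / T) / κ ≤ 1 := (div_le_one hκ).mpr hp1
      have e : F t = y₀ * (1 - Phi (t / T) / κ) + y₁ * (Phi (t / T) / κ) := by
        simp only [hF, hD]; field_simp; ring
      have m0 : m ≤ y₀ := min_le_left _ _
      have m1 : m ≤ y₁ := min_le_right _ _
      rw [e]
      nlinarith [mul_nonneg (sub_nonneg.mpr m0) (sub_nonneg.mpr hθ1),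
        mul_nonneg (sub_nonneg.mpr m1) hθ0]
    linarith [(abs_le.mp h1).1]
  refine ⟨T, hT0, fun t x => F t + Es c 2 t x, Es c 0, Es c 1, Es c 0, ?_, ?_, ?_, ?_, ?_, ?_, ?_,
    ?_, ?_, ?_, ?_, ?_⟩
  · exact (hFc.comp continuous_fst).continuousOn.add (Es_cont hb hcc 2 le_rfl _)
  · exact Es_cont hb hcc 0 (by omega) _
  · exact Es_cont hb hcc 1 (by omega) _
  · exact Es_cont hb hcc 0 (by omega) _
  · intro t _ x hx
    refine ((hFd t).add (Es_deriv_t hb hd t x hx)).congr_deriv ?_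
    ring
  · intro t _ x hx
    exact (Es_deriv_x hb 1 le_rfl t x hx).const_add (F t)
  · intro t _ x hx
    exact Es_deriv_x hb 0 (by omega) t x hx
  · intros
    rfl
  · intro x _
    simp only [hE0 0 x (by simp)]
    simp [hF, Phi_zero]
  · intro x _
    have : T / T = 1 := div_self hT0.ne'
    simp only [hE0 T x (by simp [this])]
    simp only [hF, this, hD, ← hκdef]
    field_simp
    ring
  · intro t ht
    exact ⟨hpos t ht 0 (by simp), hpos t ht 1 (by simp)⟩
  · exact hpos
end

section
/- Let T > 0 and let 0 ≤ y₀ and 0 < y₁ be constants. Suppose y : ℝ × ℝ → ℝ is such that y and its partial derivatives ∂ₜy, ∂ₓy, ∂ₓ²y exist and are continuous on [0,T] × [0,1], ∂ₜy(t,x) = ∂ₓ²y(t,x) for all (t,x) ∈ [0,T] × [0,1], y(0,x) = y₀ and y(T,x) = y₁ for all x ∈ [0,1], and the boundary controls u₁(t) = y(t,0) and u₂(t) = y(t,1) are nonnegative for all t ∈ [0,T]. Then ∫₀ᵀ ( u₁(t) + u₂(t) ) dt ≤ (2/π²) · ( y₁ e^{π²T} − y₀ ). -/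
theorem stmt14 (y₀ y₁ T : ℝ) (hy₀ : 0 ≤ y₀) (hy₁ : 0 < y₁) (hT : 0 < T)
    (y yt yx yxx : ℝ → ℝ → ℝ)
    -- `y` and all its partial derivatives are continuous on `[0,T] × [0,1]`
    (hy_cont : ContinuousOn (fun q : ℝ × ℝ => y q.1 q.2) (Set.Icc 0 T ×ˢ Set.Icc 0 1))
    (hyt_cont : ContinuousOn (fun q : ℝ × ℝ => yt q.1 q.2) (Set.Icc 0 T ×ˢ Set.Icc 0 1))
    (hyx_cont : ContinuousOn (fun q : ℝ × ℝ => yx q.1 q.2) (Set.Icc 0 T ×ˢ Set.Icc 0 1))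
    (hyxx_cont : ContinuousOn (fun q : ℝ × ℝ => yxx q.1 q.2) (Set.Icc 0 T ×ˢ Set.Icc 0 1))
    -- the partial derivatives exist on `[0,T] × [0,1]`
    (hyt : ∀ t ∈ Set.Icc (0:ℝ) T, ∀ x ∈ Set.Icc (0:ℝ) 1,
      HasDerivAt (fun s => y s x) (yt t x) t)
    (hyx : ∀ t ∈ Set.Icc (0:ℝ) T, ∀ x ∈ Set.Icc (0:ℝ) 1,
      HasDerivAt (fun x' => y t x') (yx t x) x)
    (hyxx : ∀ t ∈ Set.Icc (0:ℝ) T, ∀ x ∈ Set.Icc (0:ℝ) 1,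
      HasDerivAt (fun x' => yx t x') (yxx t x) x)
    -- `y` solves the heat equation
    (heq : ∀ t ∈ Set.Icc (0:ℝ) T, ∀ x ∈ Set.Icc (0:ℝ) 1, yt t x = yxx t x)
    -- constant initial and final data
    (hinit : ∀ x ∈ Set.Icc (0:ℝ) 1, y 0 x = y₀)
    (hfin : ∀ x ∈ Set.Icc (0:ℝ) 1, y T x = y₁)
    -- nonnegative boundary controls
    (hbd : ∀ t ∈ Set.Icc (0:ℝ) T, 0 ≤ y t 0 ∧ 0 ≤ y t 1) :
    ∫ t in (0:ℝ)..T, (y t 0 + y t 1)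
      ≤ 2 / Real.pi ^ 2 * (y₁ * Real.exp (Real.pi ^ 2 * T) - y₀) := by
  have hpi := Real.pi_pos
  -- `F` is the time derivative of `exp (π² t) sin (π x) y (t, x)`
  set F : ℝ → ℝ → ℝ := fun t x =>
    Real.exp (Real.pi ^ 2 * t) * Real.sin (Real.pi * x) * (yxx t x + Real.pi ^ 2 * y t x) with hF
  have hFc : ContinuousOn F.uncurry (Set.Icc 0 T ×ˢ Set.Icc 0 1) := by
    have h1 : Continuous (fun q : ℝ × ℝ =>
        Real.exp (Real.pi ^ 2 * q.1) * Real.sin (Real.pi * q.2)) := by fun_prop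
    exact h1.continuousOn.mul (hyxx_cont.add (continuousOn_const.mul hy_cont))
  have hslT : ∀ (f : ℝ × ℝ → ℝ), ContinuousOn f (Set.Icc 0 T ×ˢ Set.Icc 0 1) →
      ∀ x ∈ Set.Icc (0:ℝ) 1, ContinuousOn (fun t => f (t, x)) (Set.uIcc 0 T) := by
    intro f hf x hx
    refine hf.comp (by fun_prop) ?_
    intro t ht
    rw [Set.uIcc_of_le hT.le] at ht
    exact ⟨ht, hx⟩
  have hslX : ∀ (f : ℝ × ℝ → ℝ), ContinuousOn f (Set.Icc 0 T ×ˢ Set.Icc 0 1) →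
      ∀ t ∈ Set.Icc (0:ℝ) T, ContinuousOn (fun x => f (t, x)) (Set.uIcc 0 1) := by
    intro f hf t ht
    refine hf.comp (by fun_prop) ?_
    intro x hx
    rw [Set.uIcc_of_le zero_le_one] at hx
    exact ⟨ht, hx⟩
  have hswap : ∫ t in (0:ℝ)..T, ∫ x in (0:ℝ)..1, F t x
      = ∫ x in (0:ℝ)..1, ∫ t in (0:ℝ)..T, F t x := by
    apply MeasureTheory.intervalIntegral_intervalIntegral_swap
    rw [Set.uIoc_of_le hT.le, Set.uIoc_of_le zero_le_one]
    exact (hFc.integrableOn_compact (isCompact_Icc.prod isCompact_Icc)).mono_set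
      (Set.prod_mono Set.Ioc_subset_Icc_self Set.Ioc_subset_Icc_self)
  have hX : ∀ t ∈ Set.Icc (0:ℝ) T, ∫ x in (0:ℝ)..1, F t x
      = Real.pi * Real.exp (Real.pi ^ 2 * t) * (y t 0 + y t 1) := by
    intro t ht
    rw [intervalIntegral.integral_eq_sub_of_hasDerivAt
      (f := fun x => Real.exp (Real.pi ^ 2 * t) *
        (Real.sin (Real.pi * x) * yx t x - Real.pi * Real.cos (Real.pi * x) * y t x))]
    · simp
      ring
    · intro x hx
      rw [Set.uIcc_of_le zero_le_one] at hx
      have hl : HasDerivAt (fun x : ℝ => Real.pi * x) Real.pi x := by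
        simpa using (hasDerivAt_id x).const_mul Real.pi
      have h := (((hl.sin).mul (hyxx t ht x hx)).sub
        (((hl.cos).const_mul Real.pi).mul (hyx t ht x hx))).const_mul
          (Real.exp (Real.pi ^ 2 * t))
      refine h.congr_deriv ?_
      simp only [hF]
      ring
    · exact (hslX _ hFc t ht).intervalIntegrable
  have hTt : ∀ x ∈ Set.Icc (0:ℝ) 1, ∫ t in (0:ℝ)..T, F t x
      = (y₁ * Real.exp (Real.pi ^ 2 * T) - y₀) * Real.sin (Real.pi * x) := by
    intro x hx
    rw [intervalIntegral.integral_eq_sub_of_hasDerivAt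
      (f := fun t => Real.exp (Real.pi ^ 2 * t) * (Real.sin (Real.pi * x) * y t x))]
    · simp only [hinit x hx, hfin x hx]
      simp
      ring
    · intro t ht
      rw [Set.uIcc_of_le hT.le] at ht
      have hl : HasDerivAt (fun t : ℝ => Real.pi ^ 2 * t) (Real.pi ^ 2) t := by
        simpa using (hasDerivAt_id t).const_mul (Real.pi ^ 2)
      have h := hl.exp.mul ((hyt t ht x hx).const_mul (Real.sin (Real.pi * x)))
      refine h.congr_deriv ?_
      simp only [hF, heq t ht x hx]
      ring
    · exact (hslT _ hFc x hx).intervalIntegrable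
  have hsin : ∫ x in (0:ℝ)..1, Real.sin (Real.pi * x) = 2 / Real.pi := by
    rw [intervalIntegral.integral_comp_mul_left _ hpi.ne']
    simp
    ring
  have hR : ∫ x in (0:ℝ)..1, ∫ t in (0:ℝ)..T, F t x
      = (y₁ * Real.exp (Real.pi ^ 2 * T) - y₀) * (2 / Real.pi) := by
    rw [← hsin, ← intervalIntegral.integral_const_mul]
    apply intervalIntegral.integral_congr
    intro x hx
    rw [Set.uIcc_of_le zero_le_one] at hx
    exact hTt x hx
  have hL : ∫ t in (0:ℝ)..T, ∫ x in (0:ℝ)..1, F t x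
      = ∫ t in (0:ℝ)..T, Real.pi * Real.exp (Real.pi ^ 2 * t) * (y t 0 + y t 1) := by
    apply intervalIntegral.integral_congr
    intro t ht
    rw [Set.uIcc_of_le hT.le] at ht
    exact hX t ht
  have hu : ContinuousOn (fun t => y t 0 + y t 1) (Set.uIcc 0 T) :=
    (hslT _ hy_cont 0 (by simp)).add (hslT _ hy_cont 1 (by simp))
  have hmono : ∫ t in (0:ℝ)..T, Real.pi * (y t 0 + y t 1)
      ≤ ∫ t in (0:ℝ)..T, Real.pi * Real.exp (Real.pi ^ 2 * t) * (y t 0 + y t 1) := by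
    apply intervalIntegral.integral_mono_on hT.le
    · exact (continuousOn_const.mul hu).intervalIntegrable
    · have hc : Continuous (fun t : ℝ => Real.pi * Real.exp (Real.pi ^ 2 * t)) := by fun_prop
      exact (hc.continuousOn.mul hu).intervalIntegrable
    · intro t ht
      have h0 : 0 ≤ y t 0 + y t 1 := add_nonneg (hbd t ht).1 (hbd t ht).2
      have h1 : 1 ≤ Real.exp (Real.pi ^ 2 * t) :=
        Real.one_le_exp (mul_nonneg (sq_nonneg _) ht.1)
      apply mul_le_mul_of_nonneg_right _ h0
      nlinarith
  rw [intervalIntegral.integral_const_mul, ← hL, hswap, hR] at hmono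
  have key : 2 / Real.pi ^ 2 * (y₁ * Real.exp (Real.pi ^ 2 * T) - y₀)
      = (y₁ * Real.exp (Real.pi ^ 2 * T) - y₀) * (2 / Real.pi) / Real.pi := by
    field_simp
  rw [key, le_div_iff₀ hpi, mul_comm]
  exact hmono
end
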